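/- Let R be a commutative perfect ring. Then R is Artinian if and only if R is (1,1)-coherent. -/

import Mathlib

section DirectLimit

variable {R ι : Type*} [CommRing R] [Preorder ι] [DecidableEq ι] [Nonempty ι]
  [IsDirectedOrder ι] {G : ι → Type*} [∀ i, AddCommGroup (G i)] [∀ i, Module R (G i)]
  {f : ∀ i j, i ≤ j → G i →ₗ[R] G j}

/-- A finite family in a direct limit comes from a single component. -/
theorem Module.DirectLimit.exists_of_family {κ : Type*} [Finite κ]
    (z : κ → Module.DirectLimit G f) :
    ∃ i, ∃ x : κ → G i, ∀ k, Module.DirectLimit.of R ι G f i (x k) = z k := by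
  choose i x hx using fun k ↦ Module.DirectLimit.exists_of (z k)
  obtain ⟨j, hj⟩ := Finite.exists_le i
  exact ⟨j, fun k ↦ f (i k) j (hj k) (x k), fun k ↦ by rw [Module.DirectLimit.of_f, hx]⟩

/-- A direct limit of flat modules is flat. -/
theorem Module.Flat.of_directLimit [DirectedSystem G (f · · ·)] [∀ i, Module.Flat R (G i)] :
    Module.Flat R (Module.DirectLimit G f) := by
  refine Module.Flat.of_forall_isTrivialRelation fun {l r z} h ↦ ?_
  obtain ⟨i, x, hx⟩ := Module.DirectLimit.exists_of_family z
  obtain ⟨j, hij, h0⟩ : ∃ j hij, f i j hij (∑ k, r k • x k) = 0 :=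
    Module.DirectLimit.of.zero_exact (by simpa [map_sum, hx] using h)
  obtain ⟨m, a, y, hy, ha⟩ := Module.Flat.isTrivialRelation_of_sum_smul_eq_zero
    (f := r) (x := fun k ↦ f i j hij (x k)) (by simpa [map_sum] using h0)
  refine ⟨m, a, fun k ↦ Module.DirectLimit.of R ι G f j (y k), fun k ↦ ?_, ha⟩
  rw [← hx k, ← Module.DirectLimit.of_f (hij := hij), show f i j hij (x k) = _ from hy k]
  simp [map_sum]

end DirectLimit

/-- An element of a projective module lies in `I • ⊤` if every linear form maps it into `I`. -/
theorem Module.Projective.mem_smul_top_of_forall {R M : Type*} [CommRing R] [AddCommGroup M]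
    [Module R M] [Module.Projective R M] (I : Ideal R) (z : M)
    (hz : ∀ φ : M →ₗ[R] R, φ z ∈ I) : z ∈ I • (⊤ : Submodule R M) := by
  obtain ⟨s, hs⟩ := Module.Projective.out (R := R) (P := M)
  rw [← hs z, Finsupp.linearCombination_apply]
  exact Submodule.sum_mem _ fun m _ ↦
    Submodule.smul_mem_smul (hz (Finsupp.lapply m ∘ₗ s)) Submodule.mem_top

section Perfect

variable {R : Type u} [CommRing R]

/-- In a perfect ring, the chain of principal ideals generated by the partial products of a
sequence stabilizes: some partial product is divisible by all of them. -/
theorem exists_forall_prod_range_dvd_of_perfect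
    (hperf : ∀ (M : Type u) [AddCommGroup M] [Module R M],
      Module.Flat R M → Module.Projective R M) (a : ℕ → R) :
    ∃ k, ∀ n, ∏ i ∈ Finset.range n, a i ∣ ∏ i ∈ Finset.range k, a i := by
  let f : ∀ i j : ℕ, i ≤ j → R →ₗ[R] R := fun i j _ ↦
    LinearMap.mulLeft R (∏ l ∈ Finset.Ico i j, a l)
  have : DirectedSystem (fun _ : ℕ ↦ R) (f · · ·) :=
    { map_self := fun i x ↦ by simp [f]
      map_map := fun i j k hij hjk x ↦ by
        simp only [f, LinearMap.mulLeft_apply, ← mul_assoc]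
        rw [mul_comm (∏ l ∈ Finset.Ico j i, a l), Finset.prod_Ico_consecutive _ hij hjk, mul_comm] }
  let M := Module.DirectLimit (fun _ : ℕ ↦ R) f
  let ofM (i : ℕ) : R →ₗ[R] M := Module.DirectLimit.of R ℕ (fun _ ↦ R) f i
  have hof (i j : ℕ) (hij : i ≤ j) (x : R) : ofM j ((∏ l ∈ Finset.Ico i j, a l) * x) = ofM i x :=
    Module.DirectLimit.of_f (hij := hij)
  have : Module.Projective R M := hperf M Module.Flat.of_directLimit
  let I : Ideal R := ⨅ n, Ideal.span {∏ i ∈ Finset.range n, a i}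
  have hI : ofM 0 1 ∈ I • (⊤ : Submodule R M) := by
    refine Module.Projective.mem_smul_top_of_forall I _ fun φ ↦ ?_
    refine (Submodule.mem_iInf _).2 fun n ↦ Ideal.mem_span_singleton.2 ?_
    rw [← hof 0 n n.zero_le 1, ← smul_eq_mul, map_smul, map_smul, smul_eq_mul,
      ← Finset.range_eq_Ico]
    exact dvd_mul_right _ _
  have hmem : ∀ z ∈ I • (⊤ : Submodule R M), ∃ i, ∃ c ∈ I, ofM i c = z := by
    intro z hz
    refine Submodule.smul_induction_on hz (fun r hr m _ ↦ ?_) ?_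
    · obtain ⟨i, x, rfl⟩ := Module.DirectLimit.exists_of m
      exact ⟨i, r * x, I.mul_mem_right _ hr, by rw [← smul_eq_mul, map_smul]⟩
    · rintro _ _ ⟨i, c, hc, rfl⟩ ⟨j, d, hd, rfl⟩
      refine ⟨max i j, _, I.add_mem (I.mul_mem_left (∏ l ∈ Finset.Ico i (max i j), a l) hc)
        (I.mul_mem_left (∏ l ∈ Finset.Ico j (max i j), a l) hd), ?_⟩
      rw [map_add, hof _ _ (le_max_left i j), hof _ _ (le_max_right i j)]
  obtain ⟨i, c, hc, h⟩ := hmem _ hI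
  rw [← hof 0 i i.zero_le 1] at h
  obtain ⟨k, hik, hk⟩ := Module.DirectLimit.exists_eq_of_of_eq h
  refine ⟨k, fun n ↦ ?_⟩
  have hkI : ∏ l ∈ Finset.range k, a l ∈ I := by
    simp only [f, LinearMap.mulLeft_apply, mul_one] at hk
    rw [mul_comm _ (∏ l ∈ Finset.Ico 0 i, a l), Finset.prod_Ico_consecutive _ i.zero_le hik,
      ← Finset.range_eq_Ico] at hk
    exact hk ▸ I.mul_mem_left _ hc
  exact Ideal.mem_span_singleton.1 ((Submodule.mem_iInf _).1 hkI n)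

/-- A perfect ring satisfies the descending chain condition on principal ideals. -/
theorem wellFounded_dvd_and_not_dvd_of_perfect
    (hperf : ∀ (M : Type u) [AddCommGroup M] [Module R M],
      Module.Flat R M → Module.Projective R M) :
    WellFounded fun y x : R ↦ x ∣ y ∧ ¬ y ∣ x := by
  refine wellFounded_iff_isEmpty_descending_chain.2 ⟨fun ⟨b, hb⟩ ↦ ?_⟩
  choose a ha using fun n ↦ (hb n).1
  have hprod (n : ℕ) : b n = b 0 * ∏ i ∈ Finset.range n, a i := by
    induction n with
    | zero => simp
    | succ n ih => rw [ha, ih, Finset.prod_range_succ, mul_assoc]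
  obtain ⟨k, hk⟩ := exists_forall_prod_range_dvd_of_perfect hperf a
  refine (hb k).2 ?_
  rw [hprod k, hprod (k + 1)]
  exact mul_dvd_mul_left _ (hk (k + 1))

end Perfect

section PrincipalDCC

variable {R : Type*} [CommRing R]

/-- A prime ideal of a ring with the descending chain condition on principal ideals is maximal. -/
theorem Ideal.IsPrime.isMaximal_of_wellFounded_dvd
    (hwf : WellFounded fun y x : R ↦ x ∣ y ∧ ¬ y ∣ x) {P : Ideal R} (hP : P.IsPrime) :
    P.IsMaximal := by
  refine Ideal.isMaximal_iff.2 ⟨(Ideal.ne_top_iff_one P).1 hP.ne_top, fun J x hPJ hxP hxJ ↦ ?_⟩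
  obtain ⟨_, ⟨n, rfl⟩, hmin⟩ := hwf.has_min (Set.range (x ^ · : ℕ → R)) ⟨_, 0, rfl⟩
  obtain ⟨y, hy⟩ : x ^ (n + 1) ∣ x ^ n := by
    by_contra h
    exact hmin _ ⟨n + 1, rfl⟩ ⟨pow_dvd_pow x n.le_succ, h⟩
  have h0 : x ^ n * (1 - x * y) = 0 := by linear_combination hy
  have h1 : 1 - x * y ∈ P :=
    (hP.mem_or_mem (h0 ▸ P.zero_mem)).resolve_left fun h ↦ hxP (hP.mem_of_pow_mem n h)
  simpa using J.add_mem (hPJ h1) (J.mul_mem_right y hxJ)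

/-- A prime ideal of a ring with the descending chain condition on principal ideals is the
annihilator of an element. -/
theorem Ideal.IsPrime.exists_eq_ker_toSpanSingleton_of_wellFounded_dvd
    (hwf : WellFounded fun y x : R ↦ x ∣ y ∧ ¬ y ∣ x) {P : Ideal R}
    (hP : P.IsPrime) : ∃ x : R, P = LinearMap.ker (LinearMap.toSpanSingleton R R x) := by
  obtain ⟨x, hx, hmin⟩ := hwf.has_min {x : R | ∀ s, s * x = 0 → s ∈ P} ⟨1, fun s hs ↦ by
    rw [mul_one] at hs
    exact hs ▸ P.zero_mem⟩
  have hdvd (y : R) (hy : ∀ s, s * (x * y) = 0 → s ∈ P) : x * y ∣ x := by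
    by_contra h
    exact hmin _ hy ⟨dvd_mul_right _ _, h⟩
  refine ⟨x, le_antisymm (fun y hy ↦ ?_) fun s hs ↦ hx s (by simpa using hs)⟩
  obtain ⟨s, hs, hsP⟩ : ∃ s, s * (x * y) = 0 ∧ s ∉ P := by
    by_contra! h
    obtain ⟨z, hz⟩ := hdvd y h
    have h1 : 1 - y * z ∈ P := hx _ (by linear_combination hz)
    exact (Ideal.ne_top_iff_one P).1 hP.ne_top
      (by simpa using P.add_mem h1 (P.mul_mem_right z hy))
  obtain ⟨t, ht⟩ := hdvd s fun r hr ↦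
    (hP.mem_or_mem (hx (r * s) (by linear_combination hr))).resolve_right hsP
  have : y * x = 0 := by linear_combination y * ht + t * hs
  simpa using this

/-- A ring with the descending chain condition on principal ideals whose principal ideals are
finitely presented is Artinian. -/
theorem IsArtinianRing.of_wellFounded_dvd
    (hwf : WellFounded fun y x : R ↦ x ∣ y ∧ ¬ y ∣ x)
    (hfp : ∀ a : R, Module.FinitePresentation R (Ideal.span {a})) : IsArtinianRing R := by
  refine isArtinianRing_iff_isNoetherianRing_krullDimLE_zero.2
    ⟨IsNoetherianRing.of_prime fun P hP ↦ ?_,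
      Ring.KrullDimLE.mk₀ fun P hP ↦ Ideal.IsPrime.isMaximal_of_wellFounded_dvd hwf hP⟩
  obtain ⟨x, rfl⟩ := Ideal.IsPrime.exists_eq_ker_toSpanSingleton_of_wellFounded_dvd hwf hP
  have : Module.FinitePresentation R (LinearMap.range (LinearMap.toSpanSingleton R R x)) := by
    rw [LinearMap.range_toSpanSingleton]
    exact hfp x
  rw [← LinearMap.ker_rangeRestrict]
  exact Module.FinitePresentation.fg_ker _ (LinearMap.surjective_rangeRestrict _)

end PrincipalDCC

/-- a commutative perfect ring (every flat module is projective)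
is Artinian iff it is `(1,1)`-coherent (every principal ideal is finitely
presented as an `R`-module). -/
theorem stmt_7 (R : Type u) [CommRing R]
    (hperf : ∀ (M : Type u) [AddCommGroup M] [Module R M],
      Module.Flat R M → Module.Projective R M) :
    IsArtinianRing R ↔ ∀ a : R, Module.FinitePresentation R (Ideal.span {a}) :=
  ⟨fun _ _ ↦ Module.finitePresentation_of_finite R _,
    IsArtinianRing.of_wellFounded_dvd (wellFounded_dvd_and_not_dvd_of_perfect hperf)⟩
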